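/- For all real numbers a, b with 0 ≤ a ≤ 1 and 0 ≤ b ≤ 1, h₂(a⋆b) ≤ h₂(a) + h₂(b) − h₂(a)·h₂(b). -/

import Mathlib

noncomputable def h2 (p : ℝ) : ℝ := -p * Real.logb 2 p - (1 - p) * Real.logb 2 (1 - p)

noncomputable def bconv (a b : ℝ) : ℝ := a * (1 - b) + b * (1 - a)

noncomputable def gE (x : ℝ) : ℝ := ((1 + x) * Real.log (1 + x) + (1 - x) * Real.log (1 - x)) / 2

noncomputable def cE (k : ℕ) : ℝ := 1 / (2 * k + 1) - 1 / (2 * k + 2)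

lemma cE_nonneg (k : ℕ) : 0 ≤ cE k := by
  unfold cE
  rw [sub_nonneg]
  apply one_div_le_one_div_of_le <;> [positivity; linarith]

lemma gE_hasSum (x : ℝ) (hx : |x| < 1) : HasSum (fun k : ℕ => cE k * (x ^ 2) ^ (k + 1)) (gE x) := by
  have h1 := (Real.hasSum_log_sub_log_of_abs_lt_one hx).mul_left (x / 2)
  have hx2 : |x ^ 2| < 1 := by rw [abs_pow]; exact pow_lt_one₀ (abs_nonneg _) hx (by norm_num)
  have h2 := (Real.hasSum_pow_div_log_of_abs_lt_one hx2).mul_left (1 / 2)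
  have h3 := h1.sub h2
  obtain ⟨ha, hb⟩ := abs_lt.1 hx
  refine (congrArg₂ (fun f v => HasSum (f : ℕ → ℝ) (v : ℝ)) ?_ ?_).mpr h3
  · funext k
    have : (2 * (k : ℝ) + 1) ≠ 0 := by positivity
    have : ((k : ℝ) + 1) ≠ 0 := by positivity
    have : (2 * (k : ℝ) + 2) ≠ 0 := by positivity
    unfold cE
    field_simp
    ring
  · have : (1 - x ^ 2) = (1 + x) * (1 - x) := by ring
    rw [this, Real.log_mul (by linarith) (by linarith)]
    unfold gE
    ring

lemma h2_eq (p : ℝ) : h2 p = Real.binEntropy p / Real.log 2 := by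
  unfold h2 Real.binEntropy
  simp only [Real.logb, Real.log_inv]
  ring

lemma gE_eq (p : ℝ) (h0 : 0 < p) (h1 : p < 1) : gE (1 - 2 * p) = Real.log 2 - Real.binEntropy p := by
  have e1 : 1 + (1 - 2 * p) = 2 * (1 - p) := by ring
  have e2 : 1 - (1 - 2 * p) = 2 * p := by ring
  unfold gE Real.binEntropy
  rw [e1, e2, Real.log_mul (by norm_num) (by linarith), Real.log_mul (by norm_num) (by linarith)]
  simp only [Real.log_inv]
  ring

lemma gE_le (x : ℝ) (hx : |x| < 1) : gE x ≤ Real.log 2 := by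
  obtain ⟨ha, hb⟩ := abs_lt.1 hx
  have := gE_eq ((1 - x) / 2) (by linarith) (by linarith)
  rw [show 1 - 2 * ((1 - x) / 2) = x by ring] at this
  have := Real.binEntropy_nonneg (p := (1 - x) / 2) (by linarith) (by linarith)
  linarith

lemma partial_le (N : ℕ) (x : ℝ) (hx : |x| < 1) :
    ∑ k ∈ Finset.range N, cE k * (x ^ 2) ^ (k + 1) ≤ gE x :=
  sum_le_hasSum _ (fun k _ => mul_nonneg (cE_nonneg k) (by positivity)) (gE_hasSum x hx)

lemma sum_cE_le (N : ℕ) : ∑ k ∈ Finset.range N, cE k ≤ Real.log 2 := by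
  have hc : Continuous (fun x : ℝ => ∑ k ∈ Finset.range N, cE k * (x ^ 2) ^ (k + 1)) := by fun_prop
  have ht := (hc.tendsto 1).mono_left (nhdsWithin_le_nhds (s := Set.Iio 1))
  simp only [one_pow, mul_one] at ht
  refine le_of_tendsto ht ?_
  filter_upwards [Ioo_mem_nhdsLT (show (0 : ℝ) < 1 by norm_num)] with x hx
  have hx' : |x| < 1 := abs_lt.2 ⟨by linarith [hx.1], hx.2⟩
  exact (partial_le N x hx').trans (gE_le x hx')

lemma cheb (N : ℕ) (c u v : ℕ → ℝ) (hc : ∀ k, 0 ≤ c k) (hu : Antitone u) (hv : Antitone v) :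
    (∑ k ∈ Finset.range N, c k * u k) * (∑ k ∈ Finset.range N, c k * v k) ≤
    (∑ k ∈ Finset.range N, c k) * (∑ k ∈ Finset.range N, c k * (u k * v k)) := by
  have key : 0 ≤ ∑ i ∈ Finset.range N, ∑ j ∈ Finset.range N,
      c i * c j * ((u i - u j) * (v i - v j)) := by
    refine Finset.sum_nonneg fun i _ => Finset.sum_nonneg fun j _ =>
      mul_nonneg (mul_nonneg (hc i) (hc j)) ?_
    rcases le_total i j with h | h
    · exact mul_nonneg (sub_nonneg.2 (hu h)) (sub_nonneg.2 (hv h))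
    · exact mul_nonneg_of_nonpos_of_nonpos (sub_nonpos.2 (hu h)) (sub_nonpos.2 (hv h))
  have e : ∑ i ∈ Finset.range N, ∑ j ∈ Finset.range N,
      c i * c j * ((u i - u j) * (v i - v j)) =
      (∑ k ∈ Finset.range N, c k * (u k * v k)) * (∑ k ∈ Finset.range N, c k)
      + (∑ k ∈ Finset.range N, c k) * (∑ k ∈ Finset.range N, c k * (u k * v k))
      - (∑ k ∈ Finset.range N, c k * u k) * (∑ k ∈ Finset.range N, c k * v k)
      - (∑ k ∈ Finset.range N, c k * v k) * (∑ k ∈ Finset.range N, c k * u k) := by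
    simp only [Finset.sum_mul_sum, ← Finset.sum_add_distrib, ← Finset.sum_sub_distrib]
    refine Finset.sum_congr rfl fun i _ => Finset.sum_congr rfl fun j _ => ?_
    ring
  rw [e] at key
  linarith

lemma gE_mul (x y : ℝ) (hx : |x| < 1) (hy : |y| < 1) : gE x * gE y ≤ Real.log 2 * gE (x * y) := by
  have hxy : |x * y| < 1 := by
    rw [abs_mul]; exact mul_lt_one_of_nonneg_of_lt_one_left (abs_nonneg _) hx hy.le
  have anti : ∀ z : ℝ, |z| < 1 → Antitone (fun k : ℕ => (z ^ 2) ^ (k + 1)) := by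
    intro z hz i j hij
    have : z ^ 2 ≤ 1 := by rw [← sq_abs]; exact pow_le_one₀ (abs_nonneg _) hz.le
    exact pow_le_pow_of_le_one (by positivity) this (by omega)
  refine le_of_tendsto' ((gE_hasSum x hx).tendsto_sum_nat.mul (gE_hasSum y hy).tendsto_sum_nat) ?_
  intro N
  refine (cheb N cE _ _ cE_nonneg (anti x hx) (anti y hy)).trans ?_
  simp only [← mul_pow]
  have hp := partial_le N (x * y) hxy
  simp only [mul_pow] at hp ⊢
  refine mul_le_mul (sum_cE_le N) hp ?_ (Real.log_nonneg (by norm_num))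
  exact Finset.sum_nonneg fun k _ => mul_nonneg (cE_nonneg k) (by positivity)

theorem entropy_conv_upper_bound (a b : ℝ)
    (ha0 : 0 ≤ a) (ha1 : a ≤ 1) (hb0 : 0 ≤ b) (hb1 : b ≤ 1) :
    h2 (bconv a b) ≤ h2 a + h2 b - h2 a * h2 b := by
  simp only [h2_eq]
  rcases ha0.eq_or_lt with rfl | ha0
  · simp [bconv]
  rcases ha1.eq_or_lt with rfl | ha1
  · simp [bconv]
  rcases hb0.eq_or_lt with rfl | hb0
  · simp [bconv]
  rcases hb1.eq_or_lt with rfl | hb1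
  · simp [bconv]
  have h := gE_mul (1 - 2 * a) (1 - 2 * b) (abs_lt.2 ⟨by linarith, by linarith⟩)
    (abs_lt.2 ⟨by linarith, by linarith⟩)
  have e : (1 - 2 * a) * (1 - 2 * b) = 1 - 2 * bconv a b := by unfold bconv; ring
  have c0 : 0 < bconv a b := by
    unfold bconv; nlinarith [mul_pos ha0 (sub_pos.2 hb1), mul_pos hb0 (sub_pos.2 ha1)]
  have c1 : bconv a b < 1 := by
    unfold bconv; nlinarith [mul_pos ha0 hb0, mul_pos (sub_pos.2 ha1) (sub_pos.2 hb1)]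
  rw [e, gE_eq a ha0 ha1, gE_eq b hb0 hb1, gE_eq _ c0 c1] at h
  have hl : 0 < Real.log 2 := Real.log_pos (by norm_num)
  generalize Real.binEntropy (bconv a b) = C at *
  generalize Real.binEntropy a = A at *
  generalize Real.binEntropy b = B at *
  generalize Real.log 2 = L at *
  have : A / L + B / L - A / L * (B / L) - C / L = (L * (L - C) - (L - A) * (L - B)) / L ^ 2 := by
    field_simp
    ring
  have h' : 0 ≤ (L * (L - C) - (L - A) * (L - B)) / L ^ 2 := div_nonneg (by linarith) (by positivity)
  linarith
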